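/- arXiv:1206.1218 — 4 statements merged into one kernel-verified Lean document; each statement's English description precedes it below -/
import Mathlib

section
/- Let V be a finite-dimensional real inner product space, ω an alternating bilinear form on V, A : V → V the linear map satisfying ⟨A u, v⟩ = ω(u, v) for all u, v ∈ V, and c > 0 with A ∘ A = −c² · id. Then J := c⁻¹ • A is compatible with ω: ω(J u, J v) = ω(u, v) for all u, v ∈ V, and ω(v, J v) > 0 for every v ≠ 0. -/
open RealInnerProductSpace

theorem stmt1 {V : Type*} [NormedAddCommGroup V] [InnerProductSpace ℝ V]
    [FiniteDimensional ℝ V]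
    (ω : V →ₗ[ℝ] V →ₗ[ℝ] ℝ) (hω : ∀ v : V, ω v v = 0)
    (A : V →ₗ[ℝ] V) (hA : ∀ u v : V, ⟪A u, v⟫ = ω u v)
    (c : ℝ) (hc : 0 < c)
    (hA2 : A ∘ₗ A = -(c ^ 2) • (LinearMap.id : V →ₗ[ℝ] V))
    (J : V →ₗ[ℝ] V) (hJ : J = c⁻¹ • A) :
    (∀ u v : V, ω (J u) (J v) = ω u v) ∧
    (∀ v : V, v ≠ 0 → 0 < ω v (J v)) := by
  subst hJ
  have hAA (v : V) : A (A v) = -(c ^ 2) • v := by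
    simpa using LinearMap.congr_fun hA2 v
  have hskew (u v : V) : -ω v u = ω u v := LinearMap.IsAlt.neg hω v u
  refine ⟨fun u v => ?_, fun v hv => ?_⟩
  · have hωA : ω (A u) (A v) = c ^ 2 * ω u v := by
      rw [← hA, hAA, real_inner_smul_left, real_inner_comm, hA, ← hskew u v]
      ring
    simp only [LinearMap.smul_apply, map_smul, smul_eq_mul, hωA]
    field_simp
  · have hAv : A v ≠ 0 := by
      intro h
      have hzero := hAA v
      rw [h, map_zero, eq_comm, smul_eq_zero] at hzero
      exact hzero.elim (neg_ne_zero.mpr (pow_ne_zero 2 hc.ne')) hv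
    rw [← hA, LinearMap.smul_apply, real_inner_smul_right]
    exact mul_pos (inv_pos.mpr hc) (real_inner_self_pos.mpr hAv)
end

section
/- Let n ≥ 1 be a natural number, let V be a real vector space with vectors e₁, …, eₙ, f₁, …, fₙ, let β be an alternating bilinear form on V, and let ε ≥ 0. Assume β(eᵢ, fᵢ) ≥ 1 − ε for every i, and |β(eᵢ, eⱼ)| ≤ ε, |β(fᵢ, fⱼ)| ≤ ε, |β(eᵢ, fⱼ)| ≤ ε for all i ≠ j. Then for all real coefficients a₁, …, aₙ, b₁, …, bₙ, setting u = Σᵢ (aᵢ eᵢ + bᵢ fᵢ) and Ju = Σᵢ (aᵢ fᵢ − bᵢ eᵢ), one has β(u, Ju) ≥ (1 − (1 + 2n(n−1)) ε) · Σᵢ (aᵢ² + bᵢ²). -/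
theorem neg_le_mul_mul_of_abs_le {c ε : ℝ} (hc : |c| ≤ ε) (x y : ℝ) :
    -(ε * ((x ^ 2 + y ^ 2) / 2)) ≤ x * y * c := by
  obtain ⟨hl, hr⟩ := abs_le.mp hc
  nlinarith [mul_nonneg (sub_nonneg.mpr hr) (sq_nonneg (x - y)),
    mul_nonneg (neg_le_iff_add_nonneg.mp hl) (sq_nonneg (x + y))]

theorem stmt7 {V : Type*} [AddCommGroup V] [Module ℝ V]
    (n : ℕ) (hn : 1 ≤ n) (e f : Fin n → V)
    (β : V →ₗ[ℝ] V →ₗ[ℝ] ℝ) (hβ : ∀ v : V, β v v = 0)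
    (ε : ℝ) (hε : 0 ≤ ε)
    (h1 : ∀ i : Fin n, 1 - ε ≤ β (e i) (f i))
    (h2 : ∀ i j : Fin n, i ≠ j → |β (e i) (e j)| ≤ ε)
    (h3 : ∀ i j : Fin n, i ≠ j → |β (f i) (f j)| ≤ ε)
    (h4 : ∀ i j : Fin n, i ≠ j → |β (e i) (f j)| ≤ ε)
    (a b : Fin n → ℝ) :
    (1 - (1 + 2 * (n : ℝ) * ((n : ℝ) - 1)) * ε) * (∑ i, (a i ^ 2 + b i ^ 2)) ≤
      β (∑ i, (a i • e i + b i • f i)) (∑ i, (a i • f i - b i • e i)) := by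
  have hanti (v w : V) : β v w = -β w v := by
    have h := hβ (v + w)
    simp only [map_add, LinearMap.add_apply, hβ] at h
    linarith
  set s : Fin n → ℝ := fun i => a i ^ 2 + b i ^ 2 with hs
  have hexp : β (∑ i, (a i • e i + b i • f i)) (∑ i, (a i • f i - b i • e i)) =
      ∑ i, ∑ j, β (a i • e i + b i • f i) (a j • f j - b j • e j) := by
    rw [map_sum β, LinearMap.sum_apply]
    exact Finset.sum_congr rfl fun i _ => map_sum _ _ _
  have hterm (i j : Fin n) :
      (if i = j then (1 + ε) * s i else 0) - ε * (s i + s j) ≤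
        β (a i • e i + b i • f i) (a j • f j - b j • e j) := by
    simp only [map_add, map_sub, map_smul, LinearMap.add_apply, LinearMap.smul_apply,
      smul_eq_mul, hanti (f i) (e j)]
    split_ifs with hij
    · subst hij
      simp only [hβ, hs]
      nlinarith [mul_le_mul_of_nonneg_right (h1 i) (sq_nonneg (a i)),
        mul_le_mul_of_nonneg_right (h1 i) (sq_nonneg (b i))]
    · have q1 := neg_le_mul_mul_of_abs_le (h4 i j hij) (a i) (a j)
      have q2 := neg_le_mul_mul_of_abs_le (h2 i j hij) (a i) (-b j)
      have q3 := neg_le_mul_mul_of_abs_le (h3 i j hij) (b i) (a j)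
      have q4 := neg_le_mul_mul_of_abs_le (h4 j i (Ne.symm hij)) (b i) (b j)
      simp only [hs]
      linarith
  have hsum : ∑ i, ∑ j, ((if i = j then (1 + ε) * s i else 0) - ε * (s i + s j)) =
      (1 - (2 * n - 1) * ε) * ∑ i, s i := by
    simp only [Finset.sum_sub_distrib, Finset.sum_ite_eq, Finset.mem_univ, if_true,
      ← Finset.mul_sum, Finset.sum_add_distrib, Finset.sum_const, Finset.card_univ,
      Fintype.card_fin, nsmul_eq_mul]
    ring
  have hS : 0 ≤ ∑ i, s i := Finset.sum_nonneg fun i _ => by positivity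
  rw [hexp]
  refine le_trans ?_ (hsum.symm.le.trans
    (Finset.sum_le_sum fun i _ => Finset.sum_le_sum fun j _ => hterm i j))
  refine mul_le_mul_of_nonneg_right ?_ hS
  nlinarith [mul_nonneg hε (sq_nonneg ((n : ℝ) - 1))]
end

section
/- Grönwall-type integral estimate: let R > 0, let f : [0, R] → ℝ be continuous with f(0) = 0, and let g : [0, R] → ℝ be continuous. If f(r) ≤ r·g(r) + (1/r)·∫₀ʳ f(t) dt for every r ∈ (0, R], then f(r) ≤ r·g(r) + ∫₀ʳ g(t) dt for every r ∈ (0, R]. -/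
open Set Filter Topology in
/-- The average of a continuous function vanishing at `0` over `[0, r]` is a continuous function
of `r`, with value `0` at `r = 0`. -/
theorem continuous_integral_div {f : ℝ → ℝ} (hf : Continuous f) (hf0 : f 0 = 0) :
    Continuous fun r : ℝ => (∫ t in (0 : ℝ)..r, f t) / r := by
  have hF (x : ℝ) : HasDerivAt (fun r : ℝ => ∫ t in (0 : ℝ)..r, f t) (f x) x :=
    hf.integral_hasStrictDerivAt 0 x |>.hasDerivAt
  refine continuous_iff_continuousAt.2 fun x => ?_
  rcases eq_or_ne x 0 with rfl | hx
  · have h0 := (hF 0).tendsto_slope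
    rw [hf0] at h0
    refine continuousAt_iff_punctured_nhds.2 ?_
    simp only [div_zero]
    refine h0.congr fun r => ?_
    simp [slope_def_field]
  · exact (hF x).continuousAt.div continuousAt_id hx

open Set in
/-- A pointwise bound on a continuous function by its running average integrates to a bound on
the running average. -/
theorem integral_div_le_integral {R : ℝ} {f g : ℝ → ℝ} (hf : Continuous f) (hf0 : f 0 = 0)
    (hg : Continuous g)
    (h : ∀ r ∈ Ioc (0 : ℝ) R, f r ≤ r * g r + (1 / r) * ∫ t in (0 : ℝ)..r, f t)
    {r : ℝ} (hr : r ∈ Ioc (0 : ℝ) R) :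
    (∫ t in (0 : ℝ)..r, f t) / r ≤ ∫ t in (0 : ℝ)..r, g t := by
  have hF (x : ℝ) : HasDerivAt (fun r : ℝ => ∫ t in (0 : ℝ)..r, f t) (f x) x :=
    hf.integral_hasStrictDerivAt 0 x |>.hasDerivAt
  have hG (x : ℝ) : HasDerivAt (fun r : ℝ => ∫ t in (0 : ℝ)..r, g t) (g x) x :=
    hg.integral_hasStrictDerivAt 0 x |>.hasDerivAt
  have hanti : AntitoneOn
      (fun r : ℝ => (∫ t in (0 : ℝ)..r, f t) / r - ∫ t in (0 : ℝ)..r, g t) (Icc 0 R) := by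
    refine antitoneOn_of_hasDerivWithinAt_nonpos (convex_Icc 0 R)
      (f' := fun x => (f x * x - (∫ t in (0 : ℝ)..x, f t) * 1) / x ^ 2 - g x)
      ((continuous_integral_div hf hf0).sub
        (continuous_iff_continuousAt.2 fun x => (hG x).continuousAt)).continuousOn ?_ ?_
    · intro x hx
      rw [interior_Icc] at hx
      exact (((hF x).div (hasDerivAt_id x) hx.1.ne').sub (hG x)).hasDerivWithinAt
    · intro x hx
      rw [interior_Icc] at hx
      have hx0 := hx.1
      have hle := mul_le_mul_of_nonneg_right (h x ⟨hx.1, hx.2.le⟩) hx0.le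
      have heq : (x * g x + (1 / x) * ∫ t in (0 : ℝ)..x, f t) * x
          = g x * x ^ 2 + ∫ t in (0 : ℝ)..x, f t := by
        field_simp
      rw [sub_nonpos, div_le_iff₀ (by positivity)]
      linarith
  have := hanti (left_mem_Icc.2 (hr.1.le.trans hr.2)) ⟨hr.1.le, hr.2⟩ hr.1.le
  simpa using this

theorem stmt8 (R : ℝ) (hR : 0 < R) (f g : ℝ → ℝ)
    (hf : ContinuousOn f (Set.Icc 0 R)) (hf0 : f 0 = 0)
    (hg : ContinuousOn g (Set.Icc 0 R))
    (h : ∀ r ∈ Set.Ioc (0 : ℝ) R,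
      f r ≤ r * g r + (1 / r) * ∫ t in (0 : ℝ)..r, f t) :
    ∀ r ∈ Set.Ioc (0 : ℝ) R, f r ≤ r * g r + ∫ t in (0 : ℝ)..r, g t := by
  have hext (u : ℝ → ℝ) {x : ℝ} (hx : x ∈ Set.Icc 0 R) :
      Set.IccExtend hR.le ((Set.Icc 0 R).domRestrict u) x = u x :=
    Set.IccExtend_of_mem hR.le _ hx
  have hint (u : ℝ → ℝ) {r : ℝ} (hr : r ∈ Set.Ioc 0 R) :
      ∫ t in (0 : ℝ)..r, Set.IccExtend hR.le ((Set.Icc 0 R).domRestrict u) t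
        = ∫ t in (0 : ℝ)..r, u t := by
    refine intervalIntegral.integral_congr fun t ht => hext u ?_
    rw [Set.uIcc_of_le hr.1.le] at ht
    exact ⟨ht.1, ht.2.trans hr.2⟩
  intro r hr
  have key := integral_div_le_integral (R := R) hf.domRestrict.Icc_extend'
    ((hext f (Set.left_mem_Icc.2 hR.le)).trans hf0) hg.domRestrict.Icc_extend'
    (fun x hx => by
      rw [hint f hx, hext f (Set.Ioc_subset_Icc_self hx), hext g (Set.Ioc_subset_Icc_self hx)]
      exact h x hx) hr
  rw [hint f hr, hint g hr] at key
  have hr' := h r hr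
  rw [one_div_mul_eq_div] at hr'
  linarith
end

section
/- Let U ⊆ ℝ² be an open set containing the closed unit disk and let Y : ℝ² → ℝ² be a vector field that is smooth on U and whose divergence is positive at every point of U. Then there exists a smooth vector field Z : ℝ² → ℝ² whose divergence is positive at every point of ℝ², which agrees with Y on the closed unit disk, and for which there is R > 0 such that Z(x) = x whenever ‖x‖ ≥ R. -/
open scoped Topology ContDiff

theorem hasDerivAt_expNegInvGlue (x : ℝ) :
    HasDerivAt expNegInvGlue (x⁻¹ ^ 2 * expNegInvGlue x) x := by
  simpa using expNegInvGlue.hasDerivAt_polynomial_eval_inv_mul 1 x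

theorem expNegInvGlue_le_one (x : ℝ) : expNegInvGlue x ≤ 1 := by
  rcases le_or_gt x 0 with hx | hx
  · simp [expNegInvGlue.zero_of_nonpos hx]
  · simp [expNegInvGlue, not_le.2 hx, hx.le]

/-- A radial profile `φ`, vanishing up to `1` and eventually equal to `1`, such that `s * φ s` is
increasing, with derivative of prescribed size `K` times a fixed positive function on `(1, A)`. -/
theorem exists_radial_profile {K A : ℝ} (hK : 0 < K) (hKA : K ≤ A) (hA : 1 ≤ A) :
    ∃ φ : ℝ → ℝ, ContDiff ℝ ∞ φ ∧ (∀ s ≤ 1, φ s = 0) ∧ (∀ s, A + 1 ≤ s → φ s = 1) ∧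
      (∀ s, 0 ≤ deriv (fun t ↦ t * φ t) s) ∧ (∀ s, 1 < s → 0 < deriv (fun t ↦ t * φ t) s) ∧
      ∀ s < A, deriv (fun t ↦ t * φ t) s = K * ((s - 1)⁻¹ ^ 2 * expNegInvGlue (s - 1)) := by
  set g : ℝ → ℝ := fun s ↦ expNegInvGlue (s - 1) with hg
  set τ : ℝ → ℝ := fun s ↦ Real.smoothTransition (s - A) with hτ
  set ψ : ℝ → ℝ := fun s ↦ K * g s + τ s * (s - K * g s) with hψ
  have hgs : ContDiff ℝ ∞ g := expNegInvGlue.contDiff.comp (by fun_prop)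
  have hτs : ContDiff ℝ ∞ τ := Real.smoothTransition.contDiff.comp (by fun_prop)
  have hψs : ContDiff ℝ ∞ ψ := by fun_prop
  have hg' (s : ℝ) : HasDerivAt g ((s - 1)⁻¹ ^ 2 * g s) s :=
    (hasDerivAt_expNegInvGlue (s - 1)).comp_sub_const s 1
  have hτ' (s : ℝ) : HasDerivAt τ (deriv τ s) s :=
    (hτs.differentiable (by simp) s).hasDerivAt
  have hτ0 (s : ℝ) (hs : s ≤ A) : τ s = 0 :=
    Real.smoothTransition.zero_of_nonpos (by linarith)
  have hτ'0 (s : ℝ) (hs : s < A) : deriv τ s = 0 := by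
    have : τ =ᶠ[𝓝 s] fun _ ↦ 0 := by
      filter_upwards [gt_mem_nhds hs] with t ht using hτ0 t ht.le
    simpa using this.deriv_eq
  have hτmono : Monotone τ := fun s t hst ↦
    Real.smoothTransition.monotone (by linarith)
  have hψ0 (s : ℝ) (hs : s ≤ 1) : ψ s = 0 := by
    simp [hψ, hτ0 s (hs.trans hA), hg, expNegInvGlue.zero_of_nonpos (sub_nonpos.2 hs)]
  have hmul : (fun t ↦ t * (ψ t / t)) = ψ := by
    funext t
    rcases eq_or_ne t 0 with rfl | ht
    · simp [hψ0 0 zero_le_one]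
    · field_simp
  have hψ' (s : ℝ) : deriv ψ s =
      (1 - τ s) * (K * ((s - 1)⁻¹ ^ 2 * g s)) + τ s + deriv τ s * (s - K * g s) := by
    have h := ((hg' s).const_mul K).add
      ((hτ' s).mul ((hasDerivAt_id s).sub ((hg' s).const_mul K)))
    refine h.deriv.trans ?_
    simp only [id, Pi.sub_apply]
    ring
  have hτ_nonneg (s : ℝ) : 0 ≤ τ s := Real.smoothTransition.nonneg _
  have hτ_le (s : ℝ) : τ s ≤ 1 := Real.smoothTransition.le_one _
  have hlast (s : ℝ) : 0 ≤ deriv τ s * (s - K * g s) := by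
    rcases lt_or_ge s A with hs | hs
    · simp [hτ'0 s hs]
    · have : K * g s ≤ K * 1 := by gcongr; exact expNegInvGlue_le_one _
      exact mul_nonneg hτmono.deriv_nonneg (by linarith)
  have hg_nonneg (s : ℝ) : 0 ≤ g s := expNegInvGlue.nonneg _
  refine ⟨fun s ↦ ψ s / s, ?_, fun s hs ↦ by simp [hψ0 s hs], ?_, ?_, ?_, ?_⟩
  · refine contDiff_iff_contDiffAt.2 fun s ↦ ?_
    rcases lt_or_ge s 1 with hs | hs
    · refine (contDiffAt_const (c := (0 : ℝ))).congr_of_eventuallyEq ?_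
      filter_upwards [gt_mem_nhds hs] with t ht
      simp [hψ0 t ht.le]
    · exact hψs.contDiffAt.div contDiffAt_id (by simp; linarith)
  · intro s hs
    have h1 : τ s = 1 := Real.smoothTransition.one_of_one_le (by linarith)
    have : s ≠ 0 := by linarith
    simp [hψ, h1, this]
  · intro s
    rw [hmul, hψ']
    have := hτ_nonneg s
    have : 0 ≤ 1 - τ s := by linarith [hτ_le s]
    have := hg_nonneg s
    have := hlast s
    positivity
  · intro s hs
    rw [hmul, hψ']
    have hpos : 0 < K * ((s - 1)⁻¹ ^ 2 * g s) := by
      have h1 : 0 < s - 1 := by linarith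
      have := expNegInvGlue.pos_of_pos h1
      positivity
    have := hlast s
    rcases (hτ_nonneg s).eq_or_lt with h0 | h0
    · rw [← h0]; linarith
    · have : 0 ≤ (1 - τ s) * (K * ((s - 1)⁻¹ ^ 2 * g s)) :=
        mul_nonneg (by linarith [hτ_le s]) hpos.le
      linarith
  · intro s hs
    rw [hmul, hψ', hτ0 s hs.le, hτ'0 s hs]
    ring

/-- The divergence of a radial field `φ (‖x‖ ^ 2) • x` in the plane. -/
theorem trace_fderiv_radial {φ : ℝ → ℝ} (hφ : Differentiable ℝ φ)
    (x : EuclideanSpace ℝ (Fin 2)) :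
    LinearMap.trace ℝ (EuclideanSpace ℝ (Fin 2))
      (fderiv ℝ (fun y : EuclideanSpace ℝ (Fin 2) ↦ φ (‖y‖ ^ 2) • y) x :
        EuclideanSpace ℝ (Fin 2) →ₗ[ℝ] EuclideanSpace ℝ (Fin 2)) =
      2 * deriv (fun t ↦ t * φ t) (‖x‖ ^ 2) := by
  have h1 := (hφ (‖x‖ ^ 2)).hasDerivAt.comp_hasFDerivAt x
    (hasStrictFDerivAt_norm_sq x).hasFDerivAt
  have h2 := h1.smul (hasFDerivAt_id x)
  have h3 : deriv (fun t ↦ t * φ t) (‖x‖ ^ 2) = φ (‖x‖ ^ 2) + ‖x‖ ^ 2 * deriv φ (‖x‖ ^ 2) := by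
    simpa using ((hasDerivAt_id' (‖x‖ ^ 2)).fun_mul (hφ (‖x‖ ^ 2)).hasDerivAt).deriv
  rw [h3, show fderiv ℝ (fun y : EuclideanSpace ℝ (Fin 2) ↦ φ (‖y‖ ^ 2) • y) x = _ from h2.fderiv]
  have h4 (f : EuclideanSpace ℝ (Fin 2) →L[ℝ] ℝ) (v : EuclideanSpace ℝ (Fin 2)) :
      ((f.smulRight v : EuclideanSpace ℝ (Fin 2) →L[ℝ] EuclideanSpace ℝ (Fin 2)) :
        EuclideanSpace ℝ (Fin 2) →ₗ[ℝ] EuclideanSpace ℝ (Fin 2)) =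
        (f : EuclideanSpace ℝ (Fin 2) →ₗ[ℝ] ℝ).smulRight v := rfl
  rw [ContinuousLinearMap.toLinearMap_add, map_add, h4, LinearMap.trace_smulRight,
    ContinuousLinearMap.toLinearMap_smul, map_smul, ContinuousLinearMap.coe_id,
    LinearMap.trace_id]
  simp
  ring

theorem ContDiff.continuous_trace_fderiv {W : EuclideanSpace ℝ (Fin 2) → EuclideanSpace ℝ (Fin 2)}
    (hW : ContDiff ℝ ∞ W) :
    Continuous fun x ↦ LinearMap.trace ℝ (EuclideanSpace ℝ (Fin 2))
      (fderiv ℝ W x : EuclideanSpace ℝ (Fin 2) →ₗ[ℝ] EuclideanSpace ℝ (Fin 2)) :=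
  (LinearMap.continuous_of_finiteDimensional
    (LinearMap.trace ℝ (EuclideanSpace ℝ (Fin 2)) ∘ₗ
      ContinuousLinearMap.coeLM ℝ)).comp (hW.continuous_fderiv (by simp))

theorem ContDiffBump.contDiff_smul {E F : Type*} [NormedAddCommGroup E] [NormedSpace ℝ E]
    [HasContDiffBump E] [FiniteDimensional ℝ E] [NormedAddCommGroup F] [NormedSpace ℝ F] {c : E}
    (χ : ContDiffBump c) {U : Set E} (hU : IsOpen U) (hχU : Metric.closedBall c χ.rOut ⊆ U)
    {Y : E → F} (hY : ContDiffOn ℝ ∞ Y U) : ContDiff ℝ ∞ fun x ↦ χ x • Y x := by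
  refine contDiff_iff_contDiffAt.2 fun x ↦ ?_
  by_cases hx : x ∈ U
  · exact χ.contDiff.contDiffAt.smul (hY.contDiffAt (hU.mem_nhds hx))
  · have hx' : x ∉ tsupport χ := fun h ↦ hx (hχU (χ.tsupport_eq ▸ h))
    refine (contDiffAt_const (c := (0 : F))).congr_of_eventuallyEq ?_
    filter_upwards [notMem_tsupport_iff_eventuallyEq.1 hx'] with y hy
    simp [hy]


theorem stmt16 (U : Set (EuclideanSpace ℝ (Fin 2))) (hU : IsOpen U)
    (hU1 : Metric.closedBall (0 : EuclideanSpace ℝ (Fin 2)) 1 ⊆ U)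
    (Y : EuclideanSpace ℝ (Fin 2) → EuclideanSpace ℝ (Fin 2))
    (hY : ContDiffOn ℝ (⊤ : ℕ∞) Y U)
    (hdiv : ∀ x ∈ U, 0 < LinearMap.trace ℝ (EuclideanSpace ℝ (Fin 2))
      (fderiv ℝ Y x : EuclideanSpace ℝ (Fin 2) →ₗ[ℝ] EuclideanSpace ℝ (Fin 2))) :
    ∃ Z : EuclideanSpace ℝ (Fin 2) → EuclideanSpace ℝ (Fin 2),
      ContDiff ℝ (⊤ : ℕ∞) Z ∧
      (∀ x : EuclideanSpace ℝ (Fin 2), 0 < LinearMap.trace ℝ (EuclideanSpace ℝ (Fin 2))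
        (fderiv ℝ Z x : EuclideanSpace ℝ (Fin 2) →ₗ[ℝ] EuclideanSpace ℝ (Fin 2))) ∧
      (∀ x : EuclideanSpace ℝ (Fin 2), ‖x‖ ≤ 1 → Z x = Y x) ∧
      (∃ R : ℝ, 0 < R ∧ ∀ x : EuclideanSpace ℝ (Fin 2), R ≤ ‖x‖ → Z x = x) := by
  obtain ⟨δ, hδ, hδU⟩ :=
    (isCompact_closedBall (0 : EuclideanSpace ℝ (Fin 2)) 1).exists_cthickening_subset_open hU hU1
  rw [cthickening_closedBall hδ.le zero_le_one] at hδU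
  let χ : ContDiffBump (0 : EuclideanSpace ℝ (Fin 2)) :=
    ⟨1 + δ / 2, δ + 1, by positivity, by linarith⟩
  have hW := χ.contDiff_smul hU hδU hY
  set W : EuclideanSpace ℝ (Fin 2) → EuclideanSpace ℝ (Fin 2) := fun x ↦ χ x • Y x
  set D : EuclideanSpace ℝ (Fin 2) → ℝ := fun x ↦ LinearMap.trace ℝ (EuclideanSpace ℝ (Fin 2))
      (fderiv ℝ W x : EuclideanSpace ℝ (Fin 2) →ₗ[ℝ] EuclideanSpace ℝ (Fin 2)) with hD
  have hDcont : Continuous D := hW.continuous_trace_fderiv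
  have hDin (x : EuclideanSpace ℝ (Fin 2)) (hx : ‖x‖ < 1 + δ / 2) : 0 < D x := by
    have hWY : W =ᶠ[𝓝 x] Y := by
      filter_upwards [χ.eventuallyEq_one_of_mem_ball (mem_ball_zero_iff.2 hx)] with y hy
      simp [W, hy]
    rw [hD]
    simp only [hWY.fderiv_eq]
    exact hdiv x (hδU (mem_closedBall_zero_iff.2 (by linarith)))
  have hW0 (x : EuclideanSpace ℝ (Fin 2)) (hx : δ + 1 ≤ ‖x‖) : W x = 0 := by
    simp [W, χ.zero_of_le_dist (show δ + 1 ≤ dist x 0 by simpa using hx)]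
  have hDout (x : EuclideanSpace ℝ (Fin 2)) (hx : δ + 1 < ‖x‖) : D x = 0 := by
    have : W =ᶠ[𝓝 x] fun _ ↦ 0 := by
      filter_upwards [continuous_norm.continuousAt.eventually (lt_mem_nhds hx)] with y hy
      exact hW0 y hy.le
    simp [hD, this.fderiv_eq]
  set G : ℝ → ℝ := fun s ↦ (s - 1)⁻¹ ^ 2 * expNegInvGlue (s - 1) with hG
  have hGpos (s : ℝ) (hs : 1 < s) : 0 < G s := by
    have h1 : 0 < s - 1 := by linarith
    have := expNegInvGlue.pos_of_pos h1
    positivity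
  have hGcont : Continuous G := by
    have : G = deriv fun s ↦ expNegInvGlue (s - 1) := funext fun s ↦
      ((hasDerivAt_expNegInvGlue (s - 1)).comp_sub_const s 1).deriv.symm
    rw [this]
    exact ((expNegInvGlue.contDiff (n := ⊤)).comp
      (by fun_prop : ContDiff ℝ ∞ fun s : ℝ ↦ s - 1)).continuous_deriv (by simp)
  have hone_lt (x : EuclideanSpace ℝ (Fin 2)) (hx : 1 < ‖x‖) : 1 < ‖x‖ ^ 2 := by nlinarith
  let S : Set (EuclideanSpace ℝ (Fin 2)) :=
    Metric.closedBall 0 (δ + 1) ∩ {x | 1 + δ / 2 ≤ ‖x‖}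
  have hS : IsCompact S :=
    (isCompact_closedBall _ _).inter_right (isClosed_le continuous_const continuous_norm)
  have hquot : ContinuousOn (fun x ↦ -D x / G (‖x‖ ^ 2)) S := by
    refine hDcont.neg.continuousOn.div (hGcont.comp (by fun_prop)).continuousOn fun x hx ↦ ?_
    exact (hGpos _ (hone_lt x (by linarith [hx.2.out]))).ne'
  obtain ⟨C, hC⟩ := hS.bddAbove_image hquot
  set K := |C| + 1 with hK
  have hKpos : 0 < K := by positivity
  obtain ⟨φ, hφ, hφ0, hφ1, hφ_nonneg, hφ_pos, hφ_eq⟩ :=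
    exists_radial_profile (K := K) (A := K + (δ + 1) ^ 2 + 1) hKpos (by nlinarith) (by nlinarith)
  have hV : ContDiff ℝ ∞ fun x : EuclideanSpace ℝ (Fin 2) ↦ φ (‖x‖ ^ 2) • x :=
    (hφ.comp (contDiff_norm_sq ℝ)).smul contDiff_id
  refine ⟨fun x ↦ W x + φ (‖x‖ ^ 2) • x, hW.add hV, fun x ↦ ?_, fun x hx ↦ ?_,
    K + (δ + 1) ^ 2 + 1 + 1, by positivity, fun x hx ↦ ?_⟩
  · rw [fderiv_fun_add (hW.differentiable (by simp) x) (hV.differentiable (by simp) x),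
      ContinuousLinearMap.toLinearMap_add, map_add,
      trace_fderiv_radial (hφ.differentiable (by simp))]
    change 0 < D x + _
    rcases lt_or_ge ‖x‖ (1 + δ / 2) with h1 | h1
    · linarith [hDin x h1, hφ_nonneg (‖x‖ ^ 2)]
    have h1' : 1 < ‖x‖ ^ 2 := hone_lt x (by linarith)
    rcases lt_or_ge (δ + 1) ‖x‖ with h2 | h2
    · linarith [hDout x h2, hφ_pos _ h1']
    have h3 := hC ⟨x, ⟨mem_closedBall_zero_iff.2 h2, h1⟩, rfl⟩
    have hGx := hGpos _ h1'
    rw [div_le_iff₀ hGx] at h3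
    have h4 : C * G (‖x‖ ^ 2) < K * G (‖x‖ ^ 2) := by
      gcongr
      linarith [le_abs_self C]
    have h5 : ‖x‖ ^ 2 ≤ (δ + 1) ^ 2 := by gcongr
    rw [hφ_eq _ (by linarith)]
    have h6 : 0 < K * G (‖x‖ ^ 2) := by positivity
    linarith
  · have h1 : χ x = 1 := χ.one_of_mem_closedBall
      (mem_closedBall_zero_iff.2 (show ‖x‖ ≤ 1 + δ / 2 by linarith))
    simp [W, h1, hφ0 (‖x‖ ^ 2) (pow_le_one₀ (norm_nonneg x) hx)]
  · have h1 : 1 ≤ ‖x‖ := by nlinarith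
    simp [hW0 x (by nlinarith), hφ1 (‖x‖ ^ 2) (by nlinarith)]
end
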